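/- Let V be a pair potential in dimension d, stable with stability constant B, and suppose C̃(β) = ∫_{ℝ^d} (1 − e^{−β|V(x)|}) dx < ∞ for β > 0. Then for every n ≥ 2 and every bounded measurable Λ ⊂ ℝ^d of positive volume, the n-th Mayer coefficient satisfies |C_n(β, Λ)| ≤ e^{βBn} n^{n−2} C̃(β)^{n−1} / n!. Consequently, for every complex λ with |λ| < 1/(e^{βB+1} C̃(β)), the series ∑_{n≥1} |C_n(β, Λ)| |λ|^n converges, uniformly in Λ. -/

import Mathlib

open MeasureTheory
open scoped BigOperators

noncomputable section
open Classical

/-- The total pair interaction energy `∑_{1 ≤ i < j ≤ n} V (x i - x j)`. -/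
def pairEnergy {d : ℕ} (V : EuclideanSpace ℝ (Fin d) → ℝ) {n : ℕ}
    (x : Fin n → EuclideanSpace ℝ (Fin d)) : ℝ :=
  ∑ p ∈ Finset.univ.filter (fun p : Fin n × Fin n => p.1 < p.2), V (x p.1 - x p.2)

/-- The edges of a simple graph on a linearly ordered vertex type, listed as ordered pairs
`(i, j)` with `i < j` (each unordered edge `{i,j}` appears exactly once). -/
def edgePairs {α : Type*} [Fintype α] [LinearOrder α] (g : SimpleGraph α) :
    Finset (α × α) :=
  Finset.univ.filter fun p => p.1 < p.2 ∧ g.Adj p.1 p.2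

/-- The Ursell function
`Φ^T(x_1,…,x_n) = ∑_{g ∈ G_n} ∏_{{i,j} ∈ E_g} (e^{-βV(x_i-x_j)} - 1)`,
the sum running over all connected simple graphs on `{1,…,n}`. -/
def ursell {d : ℕ} (β : ℝ) (V : EuclideanSpace ℝ (Fin d) → ℝ) {n : ℕ}
    (x : Fin n → EuclideanSpace ℝ (Fin d)) : ℝ :=
  ∑ g ∈ (Finset.univ : Finset (SimpleGraph (Fin n))).filter (fun g => g.Connected),
    ∏ p ∈ edgePairs g, (Real.exp (-(β * V (x p.1 - x p.2))) - 1)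

/-- The `n`-th Mayer coefficient
`C_n(β,Λ) = (1/(n! |Λ|)) ∫_{Λ^n} Φ^T(x_1,…,x_n) dx_1⋯dx_n` for `n ≥ 2`, with `C_1 = 1`. -/
def mayerCoeff {d : ℕ} (β : ℝ) (V : EuclideanSpace ℝ (Fin d) → ℝ)
    (Λ : Set (EuclideanSpace ℝ (Fin d))) (n : ℕ) : ℝ :=
  if n ≤ 1 then 1
  else ((n.factorial : ℝ) * (volume Λ).toReal)⁻¹ *
    ∫ x in Set.univ.pi (fun _ : Fin n => Λ), ursell β V x

/-! ### Connectivity of edge sets, in terms of cuts -/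

/-- The edge `e` crosses the cut `A`. -/
def cutCross {n : ℕ} (e : Fin n × Fin n) (A : Finset (Fin n)) : Prop :=
  (e.1 ∈ A ∧ e.2 ∉ A) ∨ (e.1 ∉ A ∧ e.2 ∈ A)

/-- The edge set `g` lives on `S` and connects `S`. -/
def ConnOn {n : ℕ} (g : Finset (Fin n × Fin n)) (S : Finset (Fin n)) : Prop :=
  S.Nonempty ∧ (∀ e ∈ g, e.1 ∈ S ∧ e.2 ∈ S) ∧
    ∀ A, A ⊆ S → A.Nonempty → A ≠ S → ∃ e ∈ g, cutCross e A

def PhiOn {n : ℕ} (w : Fin n × Fin n → ℝ) (E : Finset (Fin n × Fin n)) (S : Finset (Fin n)) : ℝ :=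
  ∑ g ∈ E.powerset.filter (fun g => ConnOn g S), ∏ e ∈ g, w e

def TrOn {n : ℕ} (w : Fin n × Fin n → ℝ) (E : Finset (Fin n × Fin n)) (S : Finset (Fin n)) : ℝ :=
  ∑ g ∈ E.powerset.filter (fun g => ConnOn g S ∧ g.card + 1 = S.card), ∏ e ∈ g, w e

def UOn {n : ℕ} (v : Fin n × Fin n → ℝ) (E : Finset (Fin n × Fin n)) (S : Finset (Fin n)) : ℝ :=
  ∑ e ∈ E.filter (fun e => e.1 ∈ S ∧ e.2 ∈ S), v e

lemma cutCross_sdiff {n : ℕ} {e : Fin n × Fin n} {A S : Finset (Fin n)}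
    (h1 : e.1 ∈ S) (h2 : e.2 ∈ S) : cutCross e (S \ A) ↔ cutCross e A := by
  simp only [cutCross, Finset.mem_sdiff, h1, h2]; tauto

lemma ConnOn.insert {n : ℕ} {e : Fin n × Fin n} {g : Finset (Fin n × Fin n)} {S : Finset (Fin n)}
    (h : ConnOn g S) (h1 : e.1 ∈ S) (h2 : e.2 ∈ S) : ConnOn (insert e g) S := by
  obtain ⟨a, b, c⟩ := h
  refine ⟨a, ?_, ?_⟩
  · intro f hf
    rcases Finset.mem_insert.1 hf with rfl | hf
    · exact ⟨h1, h2⟩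
    · exact b f hf
  · intro A h1 h2 h3
    obtain ⟨f, hf, hc⟩ := c A h1 h2 h3
    exact ⟨f, Finset.mem_insert_of_mem hf, hc⟩

/-- Joining two connected pieces by an edge. -/
lemma ConnOn.join {n : ℕ} {e : Fin n × Fin n} {g1 g2 : Finset (Fin n × Fin n)}
    {S A : Finset (Fin n)} (hA : A ⊆ S) (h1 : e.1 ∈ A) (h2 : e.2 ∈ S) (h2' : e.2 ∉ A)
    (hg1 : ConnOn g1 A) (hg2 : ConnOn g2 (S \ A)) : ConnOn (Insert.insert e (g1 ∪ g2)) S := by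
  obtain ⟨a1, b1, c1⟩ := hg1
  obtain ⟨a2, b2, c2⟩ := hg2
  refine ⟨⟨_, h2⟩, ?_, ?_⟩
  · intro f hf
    simp only [Finset.mem_insert, Finset.mem_union] at hf
    rcases hf with rfl | hf | hf
    · exact ⟨hA h1, h2⟩
    · exact ⟨hA (b1 f hf).1, hA (b1 f hf).2⟩
    · have := b2 f hf
      simp only [Finset.mem_sdiff] at this
      exact ⟨this.1.1, this.2.1⟩
  · intro D hD hDn hDS
    by_contra hcon
    push Not at hcon
    have k1 : ∀ f ∈ g1, ¬ cutCross f D := fun f hf => hcon f (by simp [hf])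
    have k2 : ∀ f ∈ g2, ¬ cutCross f D := fun f hf => hcon f (by simp [hf])
    have k3 : ¬ cutCross e D := hcon e (by simp)
    -- D ∩ A is ∅ or A
    have q1 : D ∩ A = ∅ ∨ D ∩ A = A := by
      by_contra hq
      push Not at hq
      obtain ⟨f, hf, hc⟩ := c1 (D ∩ A) Finset.inter_subset_right hq.1 hq.2
      apply k1 f hf
      have := b1 f hf
      simpa [cutCross, this.1, this.2] using hc
    have q2 : D ∩ (S \ A) = ∅ ∨ D ∩ (S \ A) = S \ A := by
      by_contra hq
      push Not at hq
      obtain ⟨f, hf, hc⟩ := c2 (D ∩ (S \ A)) Finset.inter_subset_right hq.1 hq.2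
      apply k2 f hf
      have := b2 f hf
      simpa only [cutCross, Finset.mem_inter, this.1, this.2, and_true] using hc
    have e2 : e.2 ∈ S \ A := by simp [h2, h2']
    simp only [cutCross] at k3
    rcases q1 with q1 | q1 <;> rcases q2 with q2 | q2
    · obtain ⟨z, hz⟩ := hDn
      by_cases hzA : z ∈ A
      · have : z ∈ D ∩ A := by simp [hz, hzA]
        simp [q1] at this
      · have : z ∈ D ∩ (S \ A) := by simp [hz, hzA, hD hz]
        simp [q2] at this
    · have t1 : e.1 ∉ D := fun h => by
        have : e.1 ∈ D ∩ A := by simp [h, h1]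
        simp [q1] at this
      have t2 : e.2 ∈ D := by rw [← q2] at e2; exact (Finset.mem_inter.1 e2).1
      exact k3 (Or.inr ⟨t1, t2⟩)
    · have t1 : e.1 ∈ D := by rw [← q1] at h1; exact (Finset.mem_inter.1 h1).1
      have t2 : e.2 ∉ D := fun h => by
        have : e.2 ∈ D ∩ (S \ A) := Finset.mem_inter.2 ⟨h, e2⟩
        simp [q2] at this
      exact k3 (Or.inl ⟨t1, t2⟩)
    · apply hDS
      apply Finset.Subset.antisymm hD
      intro z hz
      by_cases hzA : z ∈ A
      · rw [← q1] at hzA; exact (Finset.mem_inter.1 hzA).1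
      · have : z ∈ S \ A := by simp [hz, hzA]
        rw [← q2] at this; exact (Finset.mem_inter.1 this).1

/-- The union of two pieces is not connected. -/
lemma ConnOn.not_union {n : ℕ} {e : Fin n × Fin n} {g1 g2 : Finset (Fin n × Fin n)}
    {S A : Finset (Fin n)} (hA : A ⊆ S) (h1 : e.1 ∈ A) (h2 : e.2 ∈ S) (h2' : e.2 ∉ A)
    (hg1 : ConnOn g1 A) (hg2 : ConnOn g2 (S \ A)) : ¬ ConnOn (g1 ∪ g2) S := by
  rintro ⟨-, -, c⟩
  obtain ⟨f, hf, hc⟩ := c A hA ⟨_, h1⟩ (fun h => h2' (h ▸ h2))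
  simp only [cutCross] at hc
  rcases Finset.mem_union.1 hf with hf | hf
  · have := hg1.2.1 f hf
    tauto
  · have := hg2.2.1 f hf
    simp only [Finset.mem_sdiff] at this
    tauto

lemma cut_unique_aux {n : ℕ} {e : Fin n × Fin n} {g : Finset (Fin n × Fin n)}
    {S A A' : Finset (Fin n)} (hA : A ⊆ S)
    (h1 : e.1 ∈ A) (h2 : e.2 ∉ A) (h1' : e.1 ∈ A')
    (hg : ConnOn (insert e g) S) (hc : ∀ f ∈ g, ¬ cutCross f A) (hc' : ∀ f ∈ g, ¬ cutCross f A') :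
    A ⊆ A' := by
  by_contra hcon
  obtain ⟨z, hz, hz'⟩ := Finset.not_subset.1 hcon
  obtain ⟨f, hf, hcf⟩ := hg.2.2 (A \ A') (Finset.sdiff_subset.trans hA)
    ⟨z, by simp [hz, hz']⟩ (by
      intro h
      have : e.1 ∈ A \ A' := by rw [h]; exact hA h1
      simp [h1'] at this)
  rcases Finset.mem_insert.1 hf with rfl | hf
  · simp only [cutCross, Finset.mem_sdiff] at hcf
    tauto
  · have a1 := hc f hf
    have a2 := hc' f hf
    simp only [cutCross, Finset.mem_sdiff] at hcf a1 a2
    tauto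

lemma ConnOn.exists_cut {n : ℕ} {e : Fin n × Fin n} {g : Finset (Fin n × Fin n)}
    {S : Finset (Fin n)} (h1 : e.1 ∈ S) (h2 : e.2 ∈ S)
    (hg : ConnOn (Insert.insert e g) S) (hn : ¬ ConnOn g S) :
    ∃ A ⊆ S, e.1 ∈ A ∧ e.2 ∉ A ∧ ∀ f ∈ g, ¬ cutCross f A := by
  have hgS : ∀ f ∈ g, f.1 ∈ S ∧ f.2 ∈ S := fun f hf => hg.2.1 f (by simp [hf])
  have : ∃ A ⊆ S, A.Nonempty ∧ A ≠ S ∧ ∀ f ∈ g, ¬ cutCross f A := by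
    by_contra hcon
    push Not at hcon
    exact hn ⟨hg.1, hgS, hcon⟩
  obtain ⟨A, hA, hAn, hAS, hc⟩ := this
  obtain ⟨f, hf, hcf⟩ := hg.2.2 A hA hAn hAS
  rcases Finset.mem_insert.1 hf with rfl | hf
  · rcases hcf with hcf | hcf
    · exact ⟨A, hA, hcf.1, hcf.2, hc⟩
    · refine ⟨S \ A, Finset.sdiff_subset, by simp [h1, hcf.1], by simp [hcf.2], ?_⟩
      intro f' hf'
      rw [cutCross_sdiff (hgS f' hf').1 (hgS f' hf').2]
      exact hc f' hf'
  · exact absurd hcf (hc f hf)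

/-- A piece of a cut is connected. -/
lemma ConnOn.piece {n : ℕ} {e : Fin n × Fin n} {g : Finset (Fin n × Fin n)}
    {S A : Finset (Fin n)} (hA : A ⊆ S) (he : cutCross e A)
    (hAn : A.Nonempty)
    (hg : ConnOn (Insert.insert e g) S) (hc : ∀ f ∈ g, ¬ cutCross f A) :
    ConnOn (g.filter (fun f => f.1 ∈ A ∧ f.2 ∈ A)) A := by
  have key : ∀ D ⊆ A, D.Nonempty → ¬ cutCross e D → D ≠ A →
      ∃ f ∈ g.filter (fun f => f.1 ∈ A ∧ f.2 ∈ A), cutCross f D := by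
    intro D hD hDn hce hDA
    obtain ⟨f, hf, hcf⟩ := hg.2.2 D (hD.trans hA) hDn (by
      rintro rfl
      exact hDA (Finset.Subset.antisymm hD hA))
    rcases Finset.mem_insert.1 hf with rfl | hf
    · exact absurd hcf hce
    · refine ⟨f, ?_, hcf⟩
      have := hc f hf
      simp only [Finset.mem_filter, hf, true_and]
      simp only [cutCross] at this hcf
      have i1 := @hD f.1
      have i2 := @hD f.2
      tauto
  refine ⟨hAn, fun f hf => (Finset.mem_filter.1 hf).2, ?_⟩
  intro D hD hDn hDA
  by_cases hce : cutCross e D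
  · have h2 : ¬ cutCross e (A \ D) := by
      simp only [cutCross, Finset.mem_sdiff] at hce he ⊢
      have i1 := @hD e.1
      have i2 := @hD e.2
      tauto
    have hne : (A \ D).Nonempty := by
      rw [Finset.sdiff_nonempty]
      intro h
      exact hDA (Finset.Subset.antisymm hD h)
    have hne2 : A \ D ≠ A := by
      intro h
      obtain ⟨z, hz⟩ := hDn
      have : z ∈ A \ D := by rw [h]; exact hD hz
      simp [hz] at this
    obtain ⟨f, hf, hcf⟩ := key (A \ D) Finset.sdiff_subset hne h2 hne2
    refine ⟨f, hf, ?_⟩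
    have := (Finset.mem_filter.1 hf).2
    rwa [cutCross_sdiff this.1 this.2] at hcf
  · exact key D hD hDn hce hDA

lemma ConnOn.disjoint {n : ℕ} {g1 g2 : Finset (Fin n × Fin n)} {S A : Finset (Fin n)}
    (hg1 : ConnOn g1 A) (hg2 : ConnOn g2 (S \ A)) : Disjoint g1 g2 := by
  rw [Finset.disjoint_left]
  intro f h1 h2
  have a := (hg1.2.1 f h1).1
  have b := (hg2.2.1 f h2).1
  simp [a] at b

/-- Index set of the splittings of a connected graph by a bridge `e`. -/
def splitIdx {n : ℕ} (e : Fin n × Fin n) (E : Finset (Fin n × Fin n)) (S : Finset (Fin n)) :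
    Finset (Finset (Fin n) × (Finset (Fin n × Fin n) × Finset (Fin n × Fin n))) :=
  (S.powerset ×ˢ (E.powerset ×ˢ E.powerset)).filter
    (fun t => e.1 ∈ t.1 ∧ e.2 ∉ t.1 ∧ ConnOn t.2.1 t.1 ∧ ConnOn t.2.2 (S \ t.1))

lemma mem_splitIdx {n : ℕ} {e : Fin n × Fin n} {E : Finset (Fin n × Fin n)} {S : Finset (Fin n)}
    {t : Finset (Fin n) × (Finset (Fin n × Fin n) × Finset (Fin n × Fin n))} :
    t ∈ splitIdx e E S ↔ t.1 ⊆ S ∧ t.2.1 ⊆ E ∧ t.2.2 ⊆ E ∧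
      e.1 ∈ t.1 ∧ e.2 ∉ t.1 ∧ ConnOn t.2.1 t.1 ∧ ConnOn t.2.2 (S \ t.1) := by
  simp [splitIdx, and_assoc]

lemma splitIdx_nocross {n : ℕ} {g1 g2 : Finset (Fin n × Fin n)} {S A : Finset (Fin n)}
    (hg1 : ConnOn g1 A) (hg2 : ConnOn g2 (S \ A)) : ∀ f ∈ g1 ∪ g2, ¬ cutCross f A := by
  intro f hf
  simp only [cutCross]
  rcases Finset.mem_union.1 hf with hf | hf
  · have := hg1.2.1 f hf; tauto
  · have := hg2.2.1 f hf
    simp only [Finset.mem_sdiff] at this; tauto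

lemma splitIdx_filter {n : ℕ} {g1 g2 : Finset (Fin n × Fin n)} {S A : Finset (Fin n)}
    (hg1 : ConnOn g1 A) (hg2 : ConnOn g2 (S \ A)) :
    (g1 ∪ g2).filter (fun f => f.1 ∈ A ∧ f.2 ∈ A) = g1 ∧
    (g1 ∪ g2).filter (fun f => f.1 ∈ S \ A ∧ f.2 ∈ S \ A) = g2 := by
  constructor
  · ext f
    simp only [Finset.mem_filter, Finset.mem_union]
    have a := hg1.2.1 f
    have b := hg2.2.1 f
    simp only [Finset.mem_sdiff] at b
    tauto
  · ext f
    simp only [Finset.mem_filter, Finset.mem_union]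
    have a := hg1.2.1 f
    have b := hg2.2.1 f
    simp only [Finset.mem_sdiff] at b ⊢
    tauto

lemma splitIdx_inj {n : ℕ} {e : Fin n × Fin n} {E : Finset (Fin n × Fin n)} {S : Finset (Fin n)}
    (h2 : e.2 ∈ S)
    {t t' : Finset (Fin n) × (Finset (Fin n × Fin n) × Finset (Fin n × Fin n))}
    (ht : t ∈ splitIdx e E S) (ht' : t' ∈ splitIdx e E S)
    (h : t.2.1 ∪ t.2.2 = t'.2.1 ∪ t'.2.2) : t = t' := by
  rw [mem_splitIdx] at ht ht'
  obtain ⟨a1, a2, a3, a4, a5, a6, a7⟩ := ht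
  obtain ⟨b1, b2, b3, b4, b5, b6, b7⟩ := ht'
  have hc := ConnOn.join a1 a4 h2 a5 a6 a7
  have hc' := ConnOn.join b1 b4 h2 b5 b6 b7
  have n1 := splitIdx_nocross a6 a7
  have n2 := splitIdx_nocross b6 b7
  have hA : t.1 = t'.1 := by
    apply Finset.Subset.antisymm
    · exact cut_unique_aux a1 a4 a5 b4 hc n1 (h ▸ n2)
    · exact cut_unique_aux b1 b4 b5 a4 hc' n2 (h ▸ n1)
  have f1 := splitIdx_filter a6 a7
  have f2 := splitIdx_filter b6 b7
  rw [← h, ← hA] at f2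
  ext1
  · exact hA
  · ext1
    · rw [← f1.1, f2.1]
    · rw [← f1.2, f2.2]

lemma PhiOn_insert {n : ℕ} (w : Fin n × Fin n → ℝ) {e : Fin n × Fin n}
    {E : Finset (Fin n × Fin n)} {S : Finset (Fin n)} (he : e ∉ E) (h1 : e.1 ∈ S) (h2 : e.2 ∈ S) :
    PhiOn w (insert e E) S = (1 + w e) * PhiOn w E S + w e *
      ∑ A ∈ S.powerset.filter (fun A => e.1 ∈ A ∧ e.2 ∉ A), PhiOn w E A * PhiOn w E (S \ A) := by
  have step1 : PhiOn w (insert e E) S = PhiOn w E S +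
      ∑ g ∈ E.powerset.filter (fun g => ConnOn (insert e g) S), w e * ∏ f ∈ g, w f := by
    unfold PhiOn
    rw [Finset.sum_filter, Finset.sum_powerset_insert he, ← Finset.sum_filter, ← Finset.sum_filter]
    congr 1
    apply Finset.sum_congr rfl
    intro g hg
    rw [Finset.prod_insert]
    intro h
    exact he (Finset.mem_powerset.1 (Finset.mem_filter.1 hg).1 h)
  have step2 : E.powerset.filter (fun g => ConnOn (insert e g) S) =
      E.powerset.filter (fun g => ConnOn g S) ∪
      E.powerset.filter (fun g => ConnOn (insert e g) S ∧ ¬ ConnOn g S) := by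
    ext g
    simp only [Finset.mem_filter, Finset.mem_union]
    have := fun h : ConnOn g S => h.insert (e := e) h1 h2
    tauto
  have step3 : Disjoint (E.powerset.filter (fun g => ConnOn g S))
      (E.powerset.filter (fun g => ConnOn (insert e g) S ∧ ¬ ConnOn g S)) := by
    rw [Finset.disjoint_left]
    intro g h h'
    exact (Finset.mem_filter.1 h').2.2 (Finset.mem_filter.1 h).2
  have step4 : ∑ g ∈ E.powerset.filter (fun g => ConnOn (insert e g) S ∧ ¬ ConnOn g S),
      ∏ f ∈ g, w f = ∑ t ∈ splitIdx e E S, (∏ f ∈ t.2.1, w f) * ∏ f ∈ t.2.2, w f := by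
    symm
    refine Finset.sum_bij (fun t _ => t.2.1 ∪ t.2.2) ?_ ?_ ?_ ?_
    · intro t ht
      rw [mem_splitIdx] at ht
      obtain ⟨a1, a2, a3, a4, a5, a6, a7⟩ := ht
      simp only [Finset.mem_filter, Finset.mem_powerset]
      exact ⟨Finset.union_subset a2 a3, ConnOn.join a1 a4 h2 a5 a6 a7,
        ConnOn.not_union a1 a4 h2 a5 a6 a7⟩
    · intro t ht t' ht' h
      exact splitIdx_inj h2 ht ht' h
    · intro g hg
      simp only [Finset.mem_filter, Finset.mem_powerset] at hg
      obtain ⟨g1, g2, g3⟩ := hg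
      obtain ⟨A, hA, c1, c2, c3⟩ := ConnOn.exists_cut h1 h2 g2 g3
      have hgS : ∀ f ∈ g, f.1 ∈ S ∧ f.2 ∈ S := fun f hf => g2.2.1 f (by simp [hf])
      refine ⟨(A, (g.filter (fun f => f.1 ∈ A ∧ f.2 ∈ A),
        g.filter (fun f => f.1 ∈ S \ A ∧ f.2 ∈ S \ A))), ?_, ?_⟩
      · rw [mem_splitIdx]
        refine ⟨hA, (Finset.filter_subset _ _).trans g1, (Finset.filter_subset _ _).trans g1,
          c1, c2, ?_, ?_⟩
        · exact ConnOn.piece hA (Or.inl ⟨c1, c2⟩) ⟨_, c1⟩ g2 c3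
        · refine ConnOn.piece (e := e) Finset.sdiff_subset (Or.inr ?_) ⟨e.2, ?_⟩ g2 ?_
          · simp [c1, c2, h2]
          · simp [c2, h2]
          · intro f hf
            rw [cutCross_sdiff (hgS f hf).1 (hgS f hf).2]
            exact c3 f hf
      · ext f
        simp only [Finset.mem_union, Finset.mem_filter, Finset.mem_sdiff]
        have i1 := hgS f
        have i2 := c3 f
        simp only [cutCross] at i2
        tauto
    · intro t ht
      rw [mem_splitIdx] at ht
      obtain ⟨a1, a2, a3, a4, a5, a6, a7⟩ := ht
      rw [Finset.prod_union (ConnOn.disjoint a6 a7)]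
  have step5 : ∑ t ∈ splitIdx e E S, (∏ f ∈ t.2.1, w f) * ∏ f ∈ t.2.2, w f =
      ∑ A ∈ S.powerset.filter (fun A => e.1 ∈ A ∧ e.2 ∉ A), PhiOn w E A * PhiOn w E (S \ A) := by
    rw [splitIdx, Finset.sum_filter, Finset.sum_product, Finset.sum_filter]
    apply Finset.sum_congr rfl
    intro A _
    unfold PhiOn
    rw [Finset.sum_mul_sum, Finset.sum_product, Finset.sum_filter]
    simp only [Finset.sum_filter]
    split_ifs with h
    · apply Finset.sum_congr rfl
      intro g1 _
      split_ifs with h'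
      · apply Finset.sum_congr rfl
        intro g2 _
        simp [h, h']
      · simp [h']
    · apply Finset.sum_eq_zero
      intro g1 _
      apply Finset.sum_eq_zero
      intro g2 _
      rw [if_neg]
      tauto
  rw [step1, step2, Finset.sum_union step3, ← Finset.mul_sum, ← Finset.mul_sum, step4, step5, PhiOn]
  ring

lemma TrOn_insert {n : ℕ} {w : Fin n × Fin n → ℝ} (hw : ∀ e, 0 ≤ w e) {e : Fin n × Fin n}
    {E : Finset (Fin n × Fin n)} {S : Finset (Fin n)} (he : e ∉ E) (h2 : e.2 ∈ S) :
    TrOn w E S + w e *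
      ∑ A ∈ S.powerset.filter (fun A => e.1 ∈ A ∧ e.2 ∉ A), TrOn w E A * TrOn w E (S \ A) ≤
      TrOn w (insert e E) S := by
  have step1 : TrOn w (insert e E) S = TrOn w E S +
      ∑ g ∈ E.powerset.filter (fun g => ConnOn (insert e g) S ∧ (insert e g).card + 1 = S.card),
        w e * ∏ f ∈ g, w f := by
    unfold TrOn
    rw [Finset.sum_filter, Finset.sum_powerset_insert he, ← Finset.sum_filter, ← Finset.sum_filter]
    congr 1
    apply Finset.sum_congr rfl
    intro g hg
    rw [Finset.prod_insert]
    intro h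
    exact he (Finset.mem_powerset.1 (Finset.mem_filter.1 hg).1 h)
  have step5 : ∑ t ∈ (splitIdx e E S).filter
      (fun t => t.2.1.card + 1 = t.1.card ∧ t.2.2.card + 1 = (S \ t.1).card),
        (∏ f ∈ t.2.1, w f) * ∏ f ∈ t.2.2, w f =
      ∑ A ∈ S.powerset.filter (fun A => e.1 ∈ A ∧ e.2 ∉ A), TrOn w E A * TrOn w E (S \ A) := by
    rw [splitIdx, Finset.filter_filter, Finset.sum_filter, Finset.sum_product, Finset.sum_filter]
    apply Finset.sum_congr rfl
    intro A _
    unfold TrOn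
    rw [Finset.sum_mul_sum, Finset.sum_product, Finset.sum_filter]
    simp only [Finset.sum_filter]
    split_ifs with h
    · apply Finset.sum_congr rfl
      intro g1 _
      split_ifs with h'
      · apply Finset.sum_congr rfl
        intro g2 _
        simp [h, h']
      · apply Finset.sum_eq_zero
        intro g2 _
        rw [if_neg]
        tauto
    · apply Finset.sum_eq_zero
      intro g1 _
      apply Finset.sum_eq_zero
      intro g2 _
      rw [if_neg]
      tauto
  rw [step1, ← Finset.mul_sum, ← step5]
  gcongr
  · exact hw e
  have hinj : Set.InjOn (fun t : Finset (Fin n) × (Finset (Fin n × Fin n) × Finset (Fin n × Fin n))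
      => t.2.1 ∪ t.2.2) ((splitIdx e E S).filter
      (fun t => t.2.1.card + 1 = t.1.card ∧ t.2.2.card + 1 = (S \ t.1).card)) := by
    intro t ht t' ht' h
    exact splitIdx_inj h2 (Finset.mem_filter.1 ht).1 (Finset.mem_filter.1 ht').1 h
  have himg : ∑ t ∈ (splitIdx e E S).filter
      (fun t => t.2.1.card + 1 = t.1.card ∧ t.2.2.card + 1 = (S \ t.1).card),
        (∏ f ∈ t.2.1, w f) * ∏ f ∈ t.2.2, w f =
      ∑ g ∈ ((splitIdx e E S).filter
      (fun t => t.2.1.card + 1 = t.1.card ∧ t.2.2.card + 1 = (S \ t.1).card)).image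
        (fun t => t.2.1 ∪ t.2.2), ∏ f ∈ g, w f := by
    rw [Finset.sum_image hinj]
    apply Finset.sum_congr rfl
    intro t ht
    have ht := (Finset.mem_filter.1 ht).1
    rw [mem_splitIdx] at ht
    obtain ⟨a1, a2, a3, a4, a5, a6, a7⟩ := ht
    rw [Finset.prod_union (ConnOn.disjoint a6 a7)]
  rw [himg]
  apply Finset.sum_le_sum_of_subset_of_nonneg
  · intro g hg
    obtain ⟨t, ht, rfl⟩ := Finset.mem_image.1 hg
    obtain ⟨ht, hc1, hc2⟩ := Finset.mem_filter.1 ht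
    rw [mem_splitIdx] at ht
    obtain ⟨a1, a2, a3, a4, a5, a6, a7⟩ := ht
    simp only [Finset.mem_filter, Finset.mem_powerset]
    refine ⟨Finset.union_subset a2 a3, ConnOn.join a1 a4 h2 a5 a6 a7, ?_⟩
    rw [Finset.card_insert_of_notMem (fun h => he (Finset.union_subset a2 a3 h)),
      Finset.card_union_of_disjoint (ConnOn.disjoint a6 a7)]
    have := Finset.card_sdiff_add_card_eq_card a1
    omega
  · intro g _ _
    exact Finset.prod_nonneg fun f _ => hw f

lemma PhiOn_insert_of_not {n : ℕ} (w : Fin n × Fin n → ℝ) {e : Fin n × Fin n}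
    {E : Finset (Fin n × Fin n)} {S : Finset (Fin n)} (h : ¬ (e.1 ∈ S ∧ e.2 ∈ S)) :
    PhiOn w (insert e E) S = PhiOn w E S := by
  unfold PhiOn
  congr 1
  ext g
  simp only [Finset.mem_filter, Finset.mem_powerset]
  constructor
  · rintro ⟨a, b⟩
    refine ⟨fun f hf => ?_, b⟩
    rcases Finset.mem_insert.1 (a hf) with rfl | h'
    · exact absurd (b.2.1 _ hf) h
    · exact h'
  · rintro ⟨a, b⟩
    exact ⟨a.trans (Finset.subset_insert _ _), b⟩

lemma TrOn_mono {n : ℕ} {w : Fin n × Fin n → ℝ} (hw : ∀ e, 0 ≤ w e)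
    {E E' : Finset (Fin n × Fin n)} {S : Finset (Fin n)} (h : E ⊆ E') :
    TrOn w E S ≤ TrOn w E' S := by
  unfold TrOn
  apply Finset.sum_le_sum_of_subset_of_nonneg
  · intro g hg
    simp only [Finset.mem_filter, Finset.mem_powerset] at hg ⊢
    exact ⟨hg.1.trans h, hg.2⟩
  · intro g _ _
    exact Finset.prod_nonneg fun f _ => hw f

lemma TrOn_nonneg {n : ℕ} {w : Fin n × Fin n → ℝ} (hw : ∀ e, 0 ≤ w e)
    (E : Finset (Fin n × Fin n)) (S : Finset (Fin n)) : 0 ≤ TrOn w E S :=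
  Finset.sum_nonneg fun _ _ => Finset.prod_nonneg fun f _ => hw f

/-! ### The pointwise tree bound -/

lemma UOn_insert {n : ℕ} (v : Fin n × Fin n → ℝ) {e : Fin n × Fin n}
    {E : Finset (Fin n × Fin n)} {S : Finset (Fin n)} (he : e ∉ E) (h : e.1 ∈ S ∧ e.2 ∈ S) :
    UOn v (insert e E) S = v e + UOn v E S := by
  unfold UOn
  rw [Finset.filter_insert, if_pos h, Finset.sum_insert (by simp [he])]

lemma UOn_insert_of_not {n : ℕ} (v : Fin n × Fin n → ℝ) {e : Fin n × Fin n}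
    {E : Finset (Fin n × Fin n)} {S : Finset (Fin n)} (h : ¬ (e.1 ∈ S ∧ e.2 ∈ S)) :
    UOn v (insert e E) S = UOn v E S := by
  unfold UOn
  rw [Finset.filter_insert, if_neg h]

lemma UOn_superadd {n : ℕ} {v : Fin n × Fin n → ℝ} {E : Finset (Fin n × Fin n)}
    {S A : Finset (Fin n)} (hA : A ⊆ S) (hv : ∀ e ∈ E, 0 ≤ v e) :
    UOn v E A + UOn v E (S \ A) ≤ UOn v E S := by
  unfold UOn
  rw [← Finset.sum_union]
  · apply Finset.sum_le_sum_of_subset_of_nonneg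
    · intro f hf
      simp only [Finset.mem_union, Finset.mem_filter, Finset.mem_sdiff] at hf ⊢
      have i1 := @hA f.1
      have i2 := @hA f.2
      tauto
    · intro f hf _
      exact hv f (Finset.mem_filter.1 hf).1
  · rw [Finset.disjoint_left]
    intro f hf hf'
    simp only [Finset.mem_filter, Finset.mem_sdiff] at hf hf'
    tauto

lemma UOn_subadd {n : ℕ} {v : Fin n × Fin n → ℝ} {E : Finset (Fin n × Fin n)}
    {S A : Finset (Fin n)} (hA : A ⊆ S) (hv : ∀ e ∈ E, v e ≤ 0) :
    UOn v E S ≤ UOn v E A + UOn v E (S \ A) := by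
  have := UOn_superadd (v := fun e => - v e) hA (E := E) (fun e he => by simpa using hv e he)
  have hneg : ∀ S, UOn (fun e => - v e) E S = - UOn v E S := by
    intro S; simp [UOn]
  rw [hneg, hneg, hneg] at this
  linarith

lemma ConnOn_empty_card {n : ℕ} {S : Finset (Fin n)} (h : ConnOn ∅ S) : S.card = 1 := by
  obtain ⟨⟨a, ha⟩, -, c⟩ := h
  rw [Finset.card_eq_one]
  refine ⟨a, ?_⟩
  by_contra hne
  obtain ⟨f, hf, -⟩ := c {a} (by simpa using ha) (by simp) (fun h => hne h.symm)
  simp at hf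

lemma PhiOn_neg {n : ℕ} (v : Fin n × Fin n → ℝ) (E : Finset (Fin n × Fin n))
    (hE : ∀ e ∈ E, v e ≤ 0) : ∀ S,
    |PhiOn (fun e => Real.exp (-v e) - 1) E S| ≤
      Real.exp (-UOn v E S) * TrOn (fun e => 1 - Real.exp (-|v e|)) E S := by
  have hwb : ∀ e, 0 ≤ (fun e => 1 - Real.exp (-|v e|)) e := by
    intro e; simp
  induction E using Finset.induction_on with
  | empty =>
    intro S
    by_cases h : ConnOn (∅ : Finset (Fin n × Fin n)) S
    · have := ConnOn_empty_card h
      simp [PhiOn, TrOn, UOn, Finset.filter_singleton, h, this]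
    · simp [PhiOn, TrOn, UOn, Finset.filter_singleton, h]
  | insert e E he ih =>
    intro S
    have ih := ih (fun f hf => hE f (by simp [hf]))
    have hEn : ∀ f ∈ E, v f ≤ 0 := fun f hf => hE f (by simp [hf])
    have hve : v e ≤ 0 := hE e (by simp)
    set w := fun e => Real.exp (-v e) - 1 with hw
    set wb := fun e => 1 - Real.exp (-|v e|) with hwb'
    by_cases h : e.1 ∈ S ∧ e.2 ∈ S
    · rw [PhiOn_insert w he h.1 h.2, UOn_insert v he h]
      have e1 : 1 + w e = Real.exp (-v e) := by simp [hw]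
      have e2 : w e = Real.exp (-v e) * wb e := by
        simp only [hw, hwb', abs_of_nonpos hve, neg_neg, mul_sub, mul_one, ← Real.exp_add]
        simp
      have hT := TrOn_insert hwb he h.2 (S := S) (E := E)
      have hsum : |∑ A ∈ S.powerset.filter (fun A => e.1 ∈ A ∧ e.2 ∉ A),
          PhiOn w E A * PhiOn w E (S \ A)| ≤ Real.exp (-UOn v E S) *
          ∑ A ∈ S.powerset.filter (fun A => e.1 ∈ A ∧ e.2 ∉ A),
          TrOn wb E A * TrOn wb E (S \ A) := by
        rw [Finset.mul_sum]
        refine (Finset.abs_sum_le_sum_abs _ _).trans (Finset.sum_le_sum fun A hA => ?_)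
        have hAS : A ⊆ S := Finset.mem_powerset.1 (Finset.mem_filter.1 hA).1
        rw [abs_mul]
        have t1 := TrOn_nonneg hwb E A
        have t2 := TrOn_nonneg hwb E (S \ A)
        calc _ ≤ (Real.exp (-UOn v E A) * TrOn wb E A) *
              (Real.exp (-UOn v E (S \ A)) * TrOn wb E (S \ A)) :=
              mul_le_mul (ih A) (ih _) (abs_nonneg _) (by positivity)
          _ = Real.exp (-(UOn v E A + UOn v E (S \ A))) * (TrOn wb E A * TrOn wb E (S \ A)) := by
              rw [neg_add, Real.exp_add]; ring
          _ ≤ _ := by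
              gcongr
              exact UOn_subadd hAS hEn
      calc _ ≤ |(1 + w e) * PhiOn w E S| + |w e * ∑ A ∈ S.powerset.filter
            (fun A => e.1 ∈ A ∧ e.2 ∉ A), PhiOn w E A * PhiOn w E (S \ A)| := abs_add_le _ _
        _ ≤ Real.exp (-v e) * (Real.exp (-UOn v E S) * TrOn wb E S) +
            (Real.exp (-v e) * wb e) * (Real.exp (-UOn v E S) *
          ∑ A ∈ S.powerset.filter (fun A => e.1 ∈ A ∧ e.2 ∉ A),
          TrOn wb E A * TrOn wb E (S \ A)) := by
            have p2 : 0 ≤ Real.exp (-v e) * wb e := mul_nonneg (Real.exp_pos _).le (hwb e)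
            rw [abs_mul, abs_mul, e1, e2, abs_of_pos (Real.exp_pos _), abs_of_nonneg p2]
            exact add_le_add (mul_le_mul_of_nonneg_left (ih S) (Real.exp_pos _).le)
              (mul_le_mul_of_nonneg_left hsum p2)
        _ = Real.exp (-(v e + UOn v E S)) * (TrOn wb E S + wb e *
          ∑ A ∈ S.powerset.filter (fun A => e.1 ∈ A ∧ e.2 ∉ A),
          TrOn wb E A * TrOn wb E (S \ A)) := by
            rw [neg_add, Real.exp_add]; ring
        _ ≤ _ := by gcongr
    · rw [PhiOn_insert_of_not w h, UOn_insert_of_not v h]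
      refine (ih S).trans ?_
      gcongr
      exact TrOn_mono hwb (Finset.subset_insert _ _)

lemma PhiOn_pos {n : ℕ} (v : Fin n × Fin n → ℝ) (b : ℝ) (N P : Finset (Fin n × Fin n))
    (hN : ∀ e ∈ N, v e ≤ 0) (hP : ∀ e ∈ P, 0 < v e)
    (hst : ∀ S, -(b * S.card) ≤ UOn v (N ∪ P) S) (Q : Finset (Fin n × Fin n)) (hQ : Q ⊆ P) : ∀ S,
    Real.exp (-UOn v (P \ Q) S) * |PhiOn (fun e => Real.exp (-v e) - 1) (Q ∪ N) S| ≤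
      Real.exp (b * S.card) * TrOn (fun e => 1 - Real.exp (-|v e|)) (Q ∪ N) S := by
  have hwb : ∀ e, 0 ≤ (fun e => 1 - Real.exp (-|v e|)) e := by
    intro e; simp
  have hdis : Disjoint N P := by
    rw [Finset.disjoint_left]
    intro e h h'
    linarith [hN e h, hP e h']
  induction Q using Finset.induction_on with
  | empty =>
    intro S
    have h1 := PhiOn_neg v N hN S
    have h2 : UOn v (N ∪ P) S = UOn v N S + UOn v P S := by
      unfold UOn
      rw [Finset.filter_union, Finset.sum_union]
      exact Finset.disjoint_filter_filter hdis
    have h3 := hst S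
    have t1 := TrOn_nonneg hwb N S
    simp only [Finset.empty_union, Finset.sdiff_empty]
    calc _ ≤ Real.exp (-UOn v P S) * (Real.exp (-UOn v N S) *
          TrOn (fun e => 1 - Real.exp (-|v e|)) N S) := by gcongr
      _ = Real.exp (-UOn v (N ∪ P) S) * TrOn (fun e => 1 - Real.exp (-|v e|)) N S := by
          rw [h2, neg_add, Real.exp_add]; ring
      _ ≤ _ := by
          gcongr
          linarith
  | insert e Q he ih =>
    intro S
    have heP : e ∈ P := hQ (by simp)
    have hQP : Q ⊆ P := fun f hf => hQ (by simp [hf])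
    have ih := ih hQP
    have hve := hP e heP
    have he' : e ∉ Q ∪ N := by
      simp only [Finset.mem_union, not_or]
      exact ⟨he, fun h => Finset.disjoint_left.1 hdis h heP⟩
    have hPQ : P \ Q = insert e (P \ insert e Q) := by
      ext f
      simp only [Finset.mem_sdiff, Finset.mem_insert]
      by_cases hfe : f = e
      · subst hfe; simp [heP, he]
      · simp [hfe]
    have hnot : e ∉ P \ insert e Q := by simp
    rw [hPQ] at ih
    rw [Finset.insert_union]
    set P' := P \ insert e Q with hP'
    have hP'pos : ∀ f ∈ P', 0 ≤ v f := fun f hf => (hP f (Finset.mem_sdiff.1 hf).1).le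
    set E := Q ∪ N with hEdef
    set w := fun e => Real.exp (-v e) - 1 with hw
    set wb := fun e => 1 - Real.exp (-|v e|) with hwb'
    by_cases h : e.1 ∈ S ∧ e.2 ∈ S
    · rw [PhiOn_insert w he' h.1 h.2]
      have e1 : 1 + w e = Real.exp (-v e) := by simp [hw]
      have e2 : |w e| = wb e := by
        simp only [hw, hwb', abs_of_pos hve]
        rw [abs_of_nonpos]
        · ring
        · simp [hve.le]
      have hT := TrOn_insert hwb he' h.2 (S := S) (E := E)
      have hsum : Real.exp (-UOn v P' S) * |∑ A ∈ S.powerset.filter (fun A => e.1 ∈ A ∧ e.2 ∉ A),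
          PhiOn w E A * PhiOn w E (S \ A)| ≤ Real.exp (b * S.card) *
          ∑ A ∈ S.powerset.filter (fun A => e.1 ∈ A ∧ e.2 ∉ A),
          TrOn wb E A * TrOn wb E (S \ A) := by
        calc _ ≤ Real.exp (-UOn v P' S) * ∑ A ∈ S.powerset.filter (fun A => e.1 ∈ A ∧ e.2 ∉ A),
          |PhiOn w E A * PhiOn w E (S \ A)| := by
              gcongr
              exact Finset.abs_sum_le_sum_abs _ _
          _ ≤ _ := ?_
        rw [Finset.mul_sum, Finset.mul_sum]
        refine Finset.sum_le_sum fun A hA => ?_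
        obtain ⟨hAS, hA1, hA2⟩ := Finset.mem_filter.1 hA
        have hAS : A ⊆ S := Finset.mem_powerset.1 hAS
        rw [abs_mul]
        have t1 := TrOn_nonneg hwb E A
        have t2 := TrOn_nonneg hwb E (S \ A)
        have i1 := ih A
        have i2 := ih (S \ A)
        rw [UOn_insert_of_not v (by tauto)] at i1
        rw [UOn_insert_of_not v (by simp [hA1])] at i2
        have hcard : (S.card : ℝ) = A.card + (S \ A).card := by
          rw [← Finset.card_sdiff_add_card_eq_card hAS]; push_cast; ring
        calc _ ≤ Real.exp (-(UOn v P' A + UOn v P' (S \ A))) *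
                (|PhiOn w E A| * |PhiOn w E (S \ A)|) := by
              gcongr
              exact UOn_superadd hAS hP'pos
          _ = (Real.exp (-UOn v P' A) * |PhiOn w E A|) *
                (Real.exp (-UOn v P' (S \ A)) * |PhiOn w E (S \ A)|) := by
              rw [neg_add, Real.exp_add]; ring
          _ ≤ (Real.exp (b * A.card) * TrOn wb E A) *
              (Real.exp (b * (S \ A).card) * TrOn wb E (S \ A)) :=
              mul_le_mul i1 i2 (by positivity) (by positivity)
          _ = _ := by
              rw [hcard, mul_add, Real.exp_add]; ring
      have ihS := ih S
      rw [UOn_insert v hnot h] at ihS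
      calc _ ≤ Real.exp (-UOn v P' S) * (|(1 + w e) * PhiOn w E S| + |w e * ∑ A ∈ S.powerset.filter
            (fun A => e.1 ∈ A ∧ e.2 ∉ A), PhiOn w E A * PhiOn w E (S \ A)|) := by
              gcongr
              exact abs_add_le _ _
        _ = Real.exp (-(v e + UOn v P' S)) * |PhiOn w E S| + wb e * (Real.exp (-UOn v P' S) *
            |∑ A ∈ S.powerset.filter
            (fun A => e.1 ∈ A ∧ e.2 ∉ A), PhiOn w E A * PhiOn w E (S \ A)|) := by
            rw [abs_mul, abs_mul, e1, e2, abs_of_pos (Real.exp_pos _), neg_add, Real.exp_add]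
            ring
        _ ≤ Real.exp (b * S.card) * TrOn wb E S + wb e * (Real.exp (b * S.card) *
          ∑ A ∈ S.powerset.filter (fun A => e.1 ∈ A ∧ e.2 ∉ A),
          TrOn wb E A * TrOn wb E (S \ A)) :=
            add_le_add ihS (mul_le_mul_of_nonneg_left hsum (hwb e))
        _ = Real.exp (b * S.card) * (TrOn wb E S + wb e *
          ∑ A ∈ S.powerset.filter (fun A => e.1 ∈ A ∧ e.2 ∉ A),
          TrOn wb E A * TrOn wb E (S \ A)) := by ring
        _ ≤ _ := by gcongr
    · rw [PhiOn_insert_of_not w h]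
      have ihS := ih S
      rw [UOn_insert_of_not v h] at ihS
      refine ihS.trans ?_
      gcongr
      exact TrOn_mono hwb (Finset.subset_insert _ _)

lemma PhiOn_le {n : ℕ} (v : Fin n × Fin n → ℝ) (b : ℝ) (E : Finset (Fin n × Fin n))
    (hst : ∀ S, -(b * S.card) ≤ UOn v E S) (S : Finset (Fin n)) :
    |PhiOn (fun e => Real.exp (-v e) - 1) E S| ≤
      Real.exp (b * S.card) * TrOn (fun e => 1 - Real.exp (-|v e|)) E S := by
  have hE : E.filter (fun e => v e ≤ 0) ∪ E.filter (fun e => 0 < v e) = E := by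
    ext e
    simp only [Finset.mem_union, Finset.mem_filter, ← and_or_left, le_or_gt, and_true]
  have := PhiOn_pos v b (E.filter (fun e => v e ≤ 0)) (E.filter (fun e => 0 < v e))
    (fun e he => (Finset.mem_filter.1 he).2) (fun e he => (Finset.mem_filter.1 he).2)
    (by rwa [hE]) _ (Finset.Subset.refl _) S
  rw [Finset.union_comm, hE] at this
  simpa [UOn] using this

/-! ### Trees as parent functions, and Cayley's bound -/

/-- Acyclic parent functions on `S`, rooted in `R`. -/
def parentFns {n : ℕ} (R S : Finset (Fin n)) : Finset (Fin n → Fin n) :=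
  Finset.univ.filter (fun p => (∀ v, v ∉ S → p v = v) ∧ (∀ v ∈ S, p v ∈ R ∪ S) ∧
    ∃ h : Fin n → ℕ, ∀ v ∈ S, h (p v) < h v)

lemma mem_parentFns {n : ℕ} {R S : Finset (Fin n)} {p : Fin n → Fin n} :
    p ∈ parentFns R S ↔ (∀ v, v ∉ S → p v = v) ∧ (∀ v ∈ S, p v ∈ R ∪ S) ∧
    ∃ h : Fin n → ℕ, ∀ v ∈ S, h (p v) < h v := by
  simp [parentFns]

lemma choose_sum_identity (m k : ℕ) :
    ∑ j ∈ Finset.range (m + 2), (m + 1).choose j * (k ^ j * (j * (m + 1) ^ (m + 1 - j))) =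
      (m + 1) * (k * (k + (m + 1)) ^ m) := by
  rw [Finset.sum_range_succ', add_pow k (m + 1) m,
    Finset.mul_sum (Finset.range (m + 1)), Finset.mul_sum (Finset.range (m + 1))]
  simp only [zero_mul, mul_zero, add_zero]
  apply Finset.sum_congr rfl
  intro j hj
  have h1 : (m + 1).choose (j + 1) * (j + 1) = (m + 1) * m.choose j :=
    (Nat.add_one_mul_choose_eq m j).symm
  have h2 : m + 1 - (j + 1) = m - j := by omega
  rw [h2]
  calc _ = ((m + 1).choose (j + 1) * (j + 1)) * (k ^ (j + 1) * (m + 1) ^ (m - j)) := by ring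
    _ = _ := by rw [h1]; simp only [Nat.cast_id]; ring

lemma parentFns_fiber {n : ℕ} (R S J : Finset (Fin n)) :
    ((parentFns R S).filter (fun p => S.filter (fun v => p v ∈ R) = J)).card ≤
      R.card ^ J.card * (parentFns J (S \ J)).card := by
  have hcard : (Fintype.piFinset (fun v : Fin n => if v ∈ J then R else {v})).card
      = R.card ^ J.card := by
    rw [Fintype.card_piFinset]
    have : ∀ v : Fin n, (if v ∈ J then R else {v}).card = if v ∈ J then R.card else 1 := by
      intro v; split_ifs <;> simp
    simp only [this]
    rw [Finset.prod_ite]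
    simp
  rw [← hcard, ← Finset.card_product]
  apply Finset.card_le_card_of_injOn
    (fun p => ((fun v => if v ∈ J then p v else v), (fun v => if v ∈ S \ J then p v else v)))
  · intro p hp
    obtain ⟨hp, hJp⟩ := Finset.mem_filter.1 hp
    obtain ⟨a, b, h, hh⟩ := mem_parentFns.1 hp
    rw [Finset.mem_coe, Finset.mem_product]
    constructor
    · rw [Fintype.mem_piFinset]
      intro v
      by_cases hv : v ∈ J
      · have : v ∈ S.filter (fun v => p v ∈ R) := by rw [hJp]; exact hv
        simpa [hv] using (Finset.mem_filter.1 this).2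
      · simp [hv]
    · rw [mem_parentFns]
      refine ⟨fun v hv => by simp only [hv, if_false], fun v hv => ?_, h, fun v hv => ?_⟩
      · simp only [hv, if_true]
        have hvS := (Finset.mem_sdiff.1 hv).1
        have hvJ := (Finset.mem_sdiff.1 hv).2
        have h1 : p v ∉ R := fun h => hvJ (by rw [← hJp]; exact Finset.mem_filter.2 ⟨hvS, h⟩)
        have h2 := b v hvS
        simp only [Finset.mem_union, h1, false_or] at h2
        simp only [Finset.mem_union, Finset.mem_sdiff, h2, true_and]
        tauto
      · simp only [hv, if_true]
        exact hh v (Finset.mem_sdiff.1 hv).1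
  · intro p hp q hq hpq
    have hp := (mem_parentFns.1 (Finset.mem_filter.1 hp).1).1
    have hq := (mem_parentFns.1 (Finset.mem_filter.1 hq).1).1
    simp only [Prod.mk.injEq] at hpq
    funext v
    have h1 := congrFun hpq.1 v
    have h2 := congrFun hpq.2 v
    by_cases hvS : v ∈ S
    · by_cases hvJ : v ∈ J
      · simpa [hvJ] using h1
      · simpa [hvJ, hvS] using h2
    · rw [hp v hvS, hq v hvS]

lemma card_parentFns {n : ℕ} : ∀ (m : ℕ) (R S : Finset (Fin n)), Disjoint R S → S.card = m →
    (R.card + m) * (parentFns R S).card ≤ R.card * (R.card + m) ^ m := by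
  intro m
  induction m using Nat.strong_induction_on with
  | _ m ih =>
    intro R S hRS hS
    rcases m with _ | m
    · have hS : S = ∅ := Finset.card_eq_zero.1 hS
      subst hS
      have : (parentFns R ∅).card ≤ 1 := by
        rw [Finset.card_le_one]
        intro p hp q hq
        funext v
        rw [(mem_parentFns.1 hp).1 v (by simp), (mem_parentFns.1 hq).1 v (by simp)]
      simpa using Nat.mul_le_mul_left R.card this
    · have hmaps : ∀ p ∈ parentFns R S,
          S.filter (fun v => p v ∈ R) ∈ S.powerset.filter (fun J => J.Nonempty) := by
        intro p hp
        obtain ⟨a, b, h, hh⟩ := mem_parentFns.1 hp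
        simp only [Finset.mem_filter, Finset.mem_powerset, Finset.filter_subset, true_and]
        have hne : S.Nonempty := by rw [← Finset.card_pos]; omega
        obtain ⟨v, hv, hmin⟩ := Finset.exists_min_image S h hne
        refine ⟨v, Finset.mem_filter.2 ⟨hv, ?_⟩⟩
        rcases Finset.mem_union.1 (b v hv) with h1 | h1
        · exact h1
        · exact absurd (hh v hv) (not_lt.2 (hmin _ h1))
      have h1 : (m + 1) * (parentFns R S).card ≤
          ∑ J ∈ S.powerset, (R.card ^ J.card * (J.card * (m + 1) ^ (m + 1 - J.card))) := by
        rw [Finset.card_eq_sum_card_fiberwise hmaps, Finset.mul_sum]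
        refine (Finset.sum_le_sum ?_).trans
          (Finset.sum_le_sum_of_subset (Finset.filter_subset _ _))
        intro J hJ
        obtain ⟨hJS, hJn⟩ := Finset.mem_filter.1 hJ
        have hJS := Finset.mem_powerset.1 hJS
        have hJc := Finset.card_pos.2 hJn
        have hsd := Finset.card_sdiff_add_card_eq_card hJS
        have hle := Finset.card_le_card hJS
        have := ih (m + 1 - J.card) (by omega) J (S \ J) Finset.disjoint_sdiff (by omega)
        have e1 : J.card + (m + 1 - J.card) = m + 1 := by omega
        rw [e1] at this
        calc _ ≤ (m + 1) * (R.card ^ J.card * (parentFns J (S \ J)).card) :=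
              Nat.mul_le_mul_left _ (parentFns_fiber R S J)
          _ = R.card ^ J.card * ((m + 1) * (parentFns J (S \ J)).card) := by ring
          _ ≤ _ := Nat.mul_le_mul_left _ this
      rw [Finset.sum_powerset_apply_card
        (fun j => R.card ^ j * (j * (m + 1) ^ (m + 1 - j))) (x := S), hS] at h1
      simp only [smul_eq_mul] at h1
      rw [choose_sum_identity] at h1
      have h2 : (parentFns R S).card ≤ R.card * (R.card + (m + 1)) ^ m :=
        Nat.le_of_mul_le_mul_left h1 (by omega)
      calc _ ≤ (R.card + (m + 1)) * (R.card * (R.card + (m + 1)) ^ m) :=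
            Nat.mul_le_mul_left _ h2
        _ = _ := by ring

lemma card_parentFns_root {n : ℕ} (hn : 2 ≤ n) (r : Fin n) :
    (parentFns {r} (Finset.univ.erase r)).card ≤ n ^ (n - 2) := by
  have := card_parentFns (n - 1) {r} (Finset.univ.erase r)
    (by simp) (by simp)
  obtain ⟨k, rfl⟩ : ∃ k, n = k + 2 := ⟨n - 2, by omega⟩
  simp only [Finset.card_singleton, one_mul] at this
  have e : 1 + (k + 2 - 1) = k + 2 := by omega
  rw [e] at this
  have e : k + 2 - 1 = k + 1 := by omega
  rw [e, pow_succ, mul_comm] at this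
  simpa using Nat.le_of_mul_le_mul_right this (by omega)

lemma exists_parent {n : ℕ} (r : Fin n) {g : Finset (Fin n × Fin n)}
    (hg : ConnOn g Finset.univ) :
    ∃ p ∈ parentFns {r} (Finset.univ.erase r),
      ∀ v, v ≠ r → (v, p v) ∈ g ∨ (p v, v) ∈ g := by
  have key : ∀ k : ℕ, k < n → ∃ A : Finset (Fin n), A.card = k + 1 ∧ r ∈ A ∧
      ∃ (p : Fin n → Fin n) (h : Fin n → ℕ), p r = r ∧ ∀ v ∈ A, v ≠ r →
        p v ∈ A ∧ h (p v) < h v ∧ ((v, p v) ∈ g ∨ (p v, v) ∈ g) := by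
    intro k
    induction k with
    | zero =>
      intro _
      refine ⟨{r}, by simp, by simp, id, 0, rfl, ?_⟩
      intro v hv hvr
      exact absurd (Finset.mem_singleton.1 hv) hvr
    | succ k ih =>
      intro hk
      obtain ⟨A, hA, hrA, p, h, hpr, hp⟩ := ih (by omega)
      obtain ⟨f, hf, hcf⟩ := hg.2.2 A (Finset.subset_univ _) ⟨r, hrA⟩ (by
        intro h
        rw [h] at hA
        simp at hA
        omega)
      obtain ⟨a, b, ha, hb, hab⟩ : ∃ a b, a ∈ A ∧ b ∉ A ∧ ((b, a) ∈ g ∨ (a, b) ∈ g) := by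
        rcases hcf with hcf | hcf
        · exact ⟨f.1, f.2, hcf.1, hcf.2, Or.inr hf⟩
        · exact ⟨f.2, f.1, hcf.2, hcf.1, Or.inl hf⟩
      have hbr : r ≠ b := fun h => hb (h ▸ hrA)
      refine ⟨insert b A, by rw [Finset.card_insert_of_notMem hb, hA], by simp [hrA],
        Function.update p b a, Function.update h b (h a + 1), ?_, ?_⟩
      · rw [Function.update_of_ne hbr, hpr]
      · intro v hv hvr
        have hab' : a ≠ b := fun h => hb (h ▸ ha)
        rcases Finset.mem_insert.1 hv with rfl | hv
        · simp only [Function.update_self, Function.update_of_ne hab']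
          exact ⟨by simp [ha], by omega, hab⟩
        · have hvb : v ≠ b := fun h => hb (h ▸ hv)
          obtain ⟨q1, q2, q3⟩ := hp v hv hvr
          have hpb : p v ≠ b := fun h => hb (h ▸ q1)
          simp only [Function.update_of_ne hvb, Function.update_of_ne hpb]
          exact ⟨by simp [q1], q2, q3⟩
  have hn : 0 < n := r.pos
  obtain ⟨A, hA, hrA, p, h, hpr, hp⟩ := key (n - 1) (by omega)
  have hAu : A = Finset.univ := by
    rw [← Finset.card_eq_iff_eq_univ, hA]; simp; omega
  subst hAu
  refine ⟨p, ?_, fun v hv => (hp v (Finset.mem_univ _) hv).2.2⟩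
  rw [mem_parentFns]
  refine ⟨?_, ?_, h, ?_⟩
  · intro v hv
    simp only [Finset.mem_erase, Finset.mem_univ, and_true, not_not] at hv
    rw [hv, hpr]
  · intro v _
    simp only [Finset.mem_union, Finset.mem_singleton, Finset.mem_erase, Finset.mem_univ, and_true]
    exact Classical.em _
  · intro v hv
    exact (hp v (Finset.mem_univ _) (Finset.ne_of_mem_erase hv)).2.1

lemma TrOn_le_parent {n : ℕ} (r : Fin n) (W : Fin n → Fin n → ℝ) (hW : ∀ i j, 0 ≤ W i j)
    (hsymm : ∀ i j, W i j = W j i) :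
    TrOn (fun e => W e.1 e.2) (Finset.univ.filter (fun e : Fin n × Fin n => e.1 < e.2))
      Finset.univ ≤
    ∑ p ∈ parentFns {r} (Finset.univ.erase r), ∏ v ∈ Finset.univ.erase r, W v (p v) := by
  unfold TrOn
  set Tset := (Finset.univ.filter (fun e : Fin n × Fin n => e.1 < e.2)).powerset.filter
    (fun g => ConnOn g Finset.univ ∧ g.card + 1 = (Finset.univ : Finset (Fin n)).card) with hT
  have hex : ∀ g : Finset (Fin n × Fin n), ∃ p : Fin n → Fin n, g ∈ Tset →
      p ∈ parentFns {r} (Finset.univ.erase r) ∧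
      ∀ v, v ≠ r → (v, p v) ∈ g ∨ (p v, v) ∈ g := by
    intro g
    by_cases hg : g ∈ Tset
    · obtain ⟨p, h1, h2⟩ := exists_parent r (Finset.mem_filter.1 hg).2.1
      exact ⟨p, fun _ => ⟨h1, h2⟩⟩
    · exact ⟨id, fun h => absurd h hg⟩
  choose q hq using hex
  let edge : (Fin n → Fin n) → Fin n → Fin n × Fin n := fun p v => (min v (p v), max v (p v))
  have hinj : ∀ p ∈ parentFns {r} (Finset.univ.erase r),
      Set.InjOn (edge p) (Finset.univ.erase r : Finset (Fin n)) := by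
    intro p hp v hv u hu huv
    obtain ⟨-, -, h, hh⟩ := mem_parentFns.1 hp
    have a1 := hh v hv
    have a2 := hh u hu
    by_contra hne
    simp only [edge, Prod.mk.injEq] at huv
    have : v = p u ∧ u = p v := by
      obtain ⟨h1, h2⟩ := huv
      rcases le_total v (p v) with h3 | h3 <;> rcases le_total u (p u) with h4 | h4 <;>
        simp only [min_eq_left, min_eq_right, max_eq_left, max_eq_right, h3, h4] at h1 h2 <;>
        first
        | exact absurd h1 hne
        | exact absurd h2 hne
        | exact ⟨h1, h2.symm⟩
        | exact ⟨h2, h1.symm⟩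
    rw [← this.1] at a2
    rw [← this.2] at a1
    omega
  have himg : ∀ g ∈ Tset, g = (Finset.univ.erase r).image (edge (q g)) := by
    intro g hg
    obtain ⟨hp, he⟩ := hq g hg
    obtain ⟨hgE, hgc, hcard⟩ := Finset.mem_filter.1 hg
    have hgE := Finset.mem_powerset.1 hgE
    symm
    apply Finset.eq_of_subset_of_card_le
    · intro f hf
      obtain ⟨v, hv, rfl⟩ := Finset.mem_image.1 hf
      rcases he v (Finset.ne_of_mem_erase hv) with h | h
      · have := (Finset.mem_filter.1 (hgE h)).2
        simp only at this
        simpa [edge, min_eq_left this.le, max_eq_right this.le] using h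
      · have := (Finset.mem_filter.1 (hgE h)).2
        simp only at this
        simpa [edge, min_eq_right this.le, max_eq_left this.le] using h
    · rw [Finset.card_image_of_injOn (hinj _ hp)]
      simp at hcard ⊢
      omega
  have hprod : ∀ g ∈ Tset, ∏ e ∈ g, W e.1 e.2 = ∏ v ∈ Finset.univ.erase r, W v (q g v) := by
    intro g hg
    conv_lhs => rw [himg g hg]
    rw [Finset.prod_image (hinj _ (hq g hg).1)]
    apply Finset.prod_congr rfl
    intro v _
    simp only [edge]
    rcases le_total v (q g v) with h | h
    · rw [min_eq_left h, max_eq_right h]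
    · rw [min_eq_right h, max_eq_left h, hsymm]
  have hqinj : Set.InjOn q Tset := by
    intro g hg g' hg' h
    rw [himg g hg, himg g' hg', h]
  rw [Finset.sum_congr rfl hprod,
    ← Finset.sum_image (f := fun p => ∏ v ∈ Finset.univ.erase r, W v (p v)) hqinj]
  apply Finset.sum_le_sum_of_subset_of_nonneg
  · intro p hp
    obtain ⟨g, hg, rfl⟩ := Finset.mem_image.1 hp
    exact (hq g hg).1
  · intro p _ _
    exact Finset.prod_nonneg fun v _ => hW _ _

/-! ### The Ursell function in terms of edge sets -/

lemma mem_edgePairs {n : ℕ} {g : SimpleGraph (Fin n)} {e : Fin n × Fin n} :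
    e ∈ edgePairs g ↔ e.1 < e.2 ∧ g.Adj e.1 e.2 := by
  simp [edgePairs]

lemma connected_iff_connOn {n : ℕ} (hn : 0 < n) (g : SimpleGraph (Fin n)) :
    g.Connected ↔ ConnOn (edgePairs g) Finset.univ := by
  have : Nonempty (Fin n) := ⟨⟨0, hn⟩⟩
  constructor
  · intro hg
    refine ⟨Finset.univ_nonempty, fun _ _ => by simp, ?_⟩
    rintro A - ⟨a, ha⟩ hA
    obtain ⟨b, hb⟩ : ∃ b, b ∉ A := by
      by_contra h
      push Not at h
      exact hA (Finset.eq_univ_iff_forall.2 h)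
    obtain ⟨w⟩ := hg.preconnected a b
    obtain ⟨d, -, h1, h2⟩ := w.exists_boundary_dart (A : Set (Fin n)) (by simpa using ha)
      (by simpa using hb)
    simp only [Finset.mem_coe] at h1 h2
    rcases lt_or_gt_of_ne d.adj.ne with h | h
    · exact ⟨(d.fst, d.snd), mem_edgePairs.2 ⟨h, d.adj⟩, Or.inl ⟨h1, h2⟩⟩
    · exact ⟨(d.snd, d.fst), mem_edgePairs.2 ⟨h, d.adj.symm⟩, Or.inr ⟨h2, h1⟩⟩
  · rintro ⟨-, -, hc⟩
    refine SimpleGraph.Connected.mk ?_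
    intro u v
    by_contra huv
    obtain ⟨e, he, hce⟩ := hc (Finset.univ.filter (fun w => g.Reachable u w))
      (Finset.subset_univ _) ⟨u, by simp⟩ (by
        intro h
        have := Finset.mem_univ v
        rw [← h] at this
        exact huv (by simpa using this))
    have hadj := (mem_edgePairs.1 he).2
    simp only [cutCross, Finset.mem_filter, Finset.mem_univ, true_and] at hce
    rcases hce with ⟨h1, h2⟩ | ⟨h1, h2⟩
    · exact h2 (h1.trans hadj.reachable)
    · exact h1 (h2.trans hadj.symm.reachable)

lemma ursell_eq_PhiOn {d n : ℕ} (hn : 0 < n) (β : ℝ) (V : EuclideanSpace ℝ (Fin d) → ℝ)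
    (x : Fin n → EuclideanSpace ℝ (Fin d)) :
    ursell β V x = PhiOn (fun e => Real.exp (-(β * V (x e.1 - x e.2))) - 1)
      (Finset.univ.filter (fun e : Fin n × Fin n => e.1 < e.2)) Finset.univ := by
  unfold ursell PhiOn
  refine Finset.sum_bij (fun g _ => edgePairs g) ?_ ?_ ?_ ?_
  · intro g hg
    simp only [Finset.mem_filter, Finset.mem_powerset]
    refine ⟨fun e he => ?_, (connected_iff_connOn hn g).1 (Finset.mem_filter.1 hg).2⟩
    simpa using (mem_edgePairs.1 he).1
  · intro g _ g' _ h
    have key : ∀ a b, a < b → (g.Adj a b ↔ g'.Adj a b) := by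
      intro a b hab
      have h1 : (a, b) ∈ edgePairs g ↔ (a, b) ∈ edgePairs g' := by rw [h]
      simpa [mem_edgePairs, hab] using h1
    ext a b
    rcases lt_trichotomy a b with hab | hab | hab
    · exact key a b hab
    · subst hab; simp
    · rw [g.adj_comm, g'.adj_comm]; exact key b a hab
  · intro s hs
    obtain ⟨hs, hc⟩ := Finset.mem_filter.1 hs
    have hs := Finset.mem_powerset.1 hs
    have hlt : ∀ e ∈ s, e.1 < e.2 := fun e he => by simpa using hs he
    have heq : edgePairs (SimpleGraph.fromRel (fun a b : Fin n => (a, b) ∈ s)) = s := by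
      ext e
      rw [mem_edgePairs, SimpleGraph.fromRel_adj]
      constructor
      · rintro ⟨h1, -, h2 | h2⟩
        · exact h2
        · exact absurd (hlt _ h2) (not_lt.2 h1.le)
      · intro he
        exact ⟨hlt e he, (hlt e he).ne, Or.inl he⟩
    refine ⟨SimpleGraph.fromRel (fun a b : Fin n => (a, b) ∈ s), ?_, heq⟩
    simp only [Finset.mem_filter, Finset.mem_univ, true_and]
    rw [connected_iff_connOn hn, heq]
    exact hc
  · intro g _
    rfl

lemma stab_UOn {d n : ℕ} {β B : ℝ} (hβ : 0 < β) (hB : 0 ≤ B)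
    {V : EuclideanSpace ℝ (Fin d) → ℝ}
    (hstab : ∀ (n : ℕ), 2 ≤ n → ∀ x : Fin n → EuclideanSpace ℝ (Fin d),
      -(B * n) ≤ pairEnergy V x)
    (x : Fin n → EuclideanSpace ℝ (Fin d)) (S : Finset (Fin n)) :
    -(β * B * S.card) ≤ UOn (fun e => β * V (x e.1 - x e.2))
      (Finset.univ.filter (fun e : Fin n × Fin n => e.1 < e.2)) S := by
  by_cases hS : 2 ≤ S.card
  · have h := hstab S.card hS (fun i => x (S.orderEmbOfFin rfl i))
    have heq : UOn (fun e => β * V (x e.1 - x e.2))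
      (Finset.univ.filter (fun e : Fin n × Fin n => e.1 < e.2)) S =
        β * pairEnergy V (fun i => x (S.orderEmbOfFin rfl i)) := by
      unfold UOn pairEnergy
      rw [Finset.mul_sum]
      symm
      refine Finset.sum_bij (fun p _ => (S.orderEmbOfFin rfl p.1, S.orderEmbOfFin rfl p.2))
        ?_ ?_ ?_ ?_
      · intro p hp
        simpa using hp
      · intro p _ q _ h
        simp only [Prod.mk.injEq, EmbeddingLike.apply_eq_iff_eq] at h
        exact Prod.ext h.1 h.2
      · intro e he
        simp only [Finset.mem_filter, Finset.mem_univ, true_and] at he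
        obtain ⟨h0, h1, h2⟩ := he
        rw [← Finset.mem_coe, ← Finset.range_orderEmbOfFin S rfl] at h1 h2
        obtain ⟨i, hi⟩ := h1
        obtain ⟨j, hj⟩ := h2
        refine ⟨(i, j), ?_, ?_⟩
        · rw [← hi, ← hj] at h0
          simpa using h0
        · simp [hi, hj]
      · intro p _
        rfl
    rw [heq]
    have := mul_le_mul_of_nonneg_left h hβ.le
    linarith
  · have hU : UOn (fun e => β * V (x e.1 - x e.2))
      (Finset.univ.filter (fun e : Fin n × Fin n => e.1 < e.2)) S = 0 := by
      unfold UOn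
      rw [Finset.filter_eq_empty_iff.2, Finset.sum_empty]
      rintro e he ⟨h1, h2⟩
      have := Finset.card_le_one.1 (by omega : S.card ≤ 1) _ h1 _ h2
      simp [this] at he
    rw [hU]
    have : 0 ≤ β * B * S.card := by positivity
    linarith

lemma abs_ursell_le {d n : ℕ} {β B : ℝ} (hβ : 0 < β) (hB : 0 ≤ B)
    {V : EuclideanSpace ℝ (Fin d) → ℝ} (hVsymm : ∀ x, V (-x) = V x)
    (hstab : ∀ (n : ℕ), 2 ≤ n → ∀ x : Fin n → EuclideanSpace ℝ (Fin d),
      -(B * n) ≤ pairEnergy V x)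
    (x : Fin n → EuclideanSpace ℝ (Fin d)) (r : Fin n) :
    |ursell β V x| ≤ Real.exp (β * B * n) *
      ∑ p ∈ parentFns {r} (Finset.univ.erase r), ∏ v ∈ Finset.univ.erase r,
        (1 - Real.exp (-(β * |V (x v - x (p v))|))) := by
  rw [ursell_eq_PhiOn r.pos]
  refine (PhiOn_le (fun e => β * V (x e.1 - x e.2)) (β * B) _ (stab_UOn hβ hB hstab x) _).trans ?_
  rw [Finset.card_univ, Fintype.card_fin]
  gcongr
  have := TrOn_le_parent r (fun i j => 1 - Real.exp (-(β * |V (x i - x j)|)))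
    (fun i j => by
      have : 0 ≤ β * |V (x i - x j)| := by positivity
      simp [this])
    (fun i j => by rw [← neg_sub (x j) (x i), hVsymm])
  simpa [abs_mul, abs_of_pos hβ] using this

/-! ### Integration -/

lemma lmarginal_tree {d n : ℕ} {f : EuclideanSpace ℝ (Fin d) → ENNReal} (hf : Measurable f)
    (p : Fin n → Fin n) (h : Fin n → ℕ) : ∀ (k : ℕ) (S : Finset (Fin n)), S.card = k →
    (∀ v ∈ S, h (p v) < h v) → ∀ x : Fin n → EuclideanSpace ℝ (Fin d),
    lmarginal (fun _ => volume) S (fun x => ∏ v ∈ S, f (x v - x (p v))) x ≤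
      (∫⁻ y, f y) ^ k := by
  intro k
  induction k with
  | zero =>
    intro S hS _ x
    rw [Finset.card_eq_zero.1 hS]
    simp
  | succ k ih =>
    intro S hS hh x
    have hne : S.Nonempty := by rw [← Finset.card_pos]; omega
    obtain ⟨v, hv, hmax⟩ := Finset.exists_max_image S h hne
    have hmeas : ∀ T : Finset (Fin n), Measurable
        (fun x : Fin n → EuclideanSpace ℝ (Fin d) => ∏ v ∈ T, f (x v - x (p v))) := by
      intro T
      refine Finset.measurable_prod _ fun u _ => hf.comp ?_
      exact (measurable_pi_apply u).sub (measurable_pi_apply (p u))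
    rw [← lmarginal.congr_simp (fun _ => volume) _ rfl _ _ (Finset.insert_erase hv) _ _ rfl _ _ rfl]
    rw [lmarginal_insert' _ (hmeas S) (Finset.notMem_erase v S)]
    have hin : (fun x : Fin n → EuclideanSpace ℝ (Fin d) => ∫⁻ y, ∏ u ∈ S,
        f (Function.update x v y u - Function.update x v y (p u))) =
        fun x => (∫⁻ y, f y) * ∏ u ∈ S.erase v, f (x u - x (p u)) := by
      funext x
      have h1 : ∀ y, ∏ u ∈ S, f (Function.update x v y u - Function.update x v y (p u)) =
          f (y - x (p v)) * ∏ u ∈ S.erase v, f (x u - x (p u)) := by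
        intro y
        rw [← Finset.mul_prod_erase S _ hv]
        have hpv : p v ≠ v := fun h' => by have := hh v hv; rw [h'] at this; omega
        congr 1
        · rw [Function.update_self, Function.update_of_ne hpv]
        · apply Finset.prod_congr rfl
          intro u hu
          have huS := Finset.mem_of_mem_erase hu
          have h2 : p u ≠ v := fun h' => by
            have := hh u huS
            have := hmax u huS
            rw [h'] at *
            omega
          rw [Function.update_of_ne (Finset.ne_of_mem_erase hu), Function.update_of_ne h2]
      simp only [h1]
      rw [lintegral_mul_const]
      · congr 1
        exact lintegral_sub_right_eq_self f (x (p v))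
      · exact hf.comp (measurable_id.sub_const _)
    rw [hin]
    have hcm : lmarginal (fun _ => volume) (S.erase v)
        (fun x : Fin n → EuclideanSpace ℝ (Fin d) =>
          (∫⁻ y, f y) * ∏ u ∈ S.erase v, f (x u - x (p u))) x =
        (∫⁻ y, f y) * lmarginal (fun _ => volume) (S.erase v)
          (fun x => ∏ u ∈ S.erase v, f (x u - x (p u))) x := by
      unfold lmarginal
      rw [lintegral_const_mul]
      exact (hmeas (S.erase v)).comp measurable_updateFinset
    rw [hcm, pow_succ']
    gcongr
    exact ih (S.erase v) (by rw [Finset.card_erase_of_mem hv]; omega)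
      (fun u hu => hh u (Finset.mem_of_mem_erase hu)) x

lemma lintegral_tree {d n : ℕ} {f : EuclideanSpace ℝ (Fin d) → ENNReal} (hf : Measurable f)
    (r : Fin n) (p : Fin n → Fin n) (hp : p ∈ parentFns {r} (Finset.univ.erase r))
    (Λ : Set (EuclideanSpace ℝ (Fin d))) (hΛ : MeasurableSet Λ) :
    ∫⁻ x in Set.univ.pi (fun _ : Fin n => Λ), ∏ v ∈ Finset.univ.erase r, f (x v - x (p v)) ≤
      volume Λ * (∫⁻ y, f y) ^ (n - 1) := by
  obtain ⟨-, -, h, hh⟩ := mem_parentFns.1 hp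
  have hmeas : Measurable (fun x : Fin n → EuclideanSpace ℝ (Fin d) =>
      ∏ v ∈ Finset.univ.erase r, f (x v - x (p v))) := by
    refine Finset.measurable_prod _ fun u _ => hf.comp ?_
    exact (measurable_pi_apply u).sub (measurable_pi_apply (p u))
  have hind : Measurable (Λ.indicator (1 : EuclideanSpace ℝ (Fin d) → ENNReal)) :=
    measurable_one.indicator hΛ
  have hmeas2 : Measurable (fun x : Fin n → EuclideanSpace ℝ (Fin d) =>
      Λ.indicator 1 (x r) * ∏ v ∈ Finset.univ.erase r, f (x v - x (p v))) :=
    (hind.comp (measurable_pi_apply r)).mul hmeas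
  calc _ ≤ ∫⁻ x : Fin n → EuclideanSpace ℝ (Fin d),
        Λ.indicator 1 (x r) * ∏ v ∈ Finset.univ.erase r, f (x v - x (p v)) := by
        rw [← lintegral_indicator (MeasurableSet.univ_pi fun _ => hΛ)]
        apply lintegral_mono
        intro x
        by_cases hx : x ∈ Set.univ.pi (fun _ : Fin n => Λ)
        · have hxr : x r ∈ Λ := hx r (Set.mem_univ _)
          simp [hx, hxr]
        · simp [hx]
    _ ≤ _ := ?_
  rw [volume_pi, lintegral_eq_lmarginal_univ (fun _ => 0),
    ← lmarginal.congr_simp (fun _ => volume) _ rfl _ _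
      (Finset.insert_erase (Finset.mem_univ r)) _ _ rfl _ _ rfl,
    lmarginal_insert _ hmeas2 (Finset.notMem_erase _ _)]
  have hle : ∀ y : EuclideanSpace ℝ (Fin d),
      lmarginal (fun _ => volume) (Finset.univ.erase r) (fun x : Fin n → EuclideanSpace ℝ (Fin d) =>
      Λ.indicator 1 (x r) * ∏ v ∈ Finset.univ.erase r, f (x v - x (p v)))
        (Function.update (fun _ => 0) r y) ≤
      Λ.indicator 1 y * (∫⁻ y, f y) ^ (n - 1) := by
    intro y
    have h1 := lmarginal_tree hf p h (n - 1) (Finset.univ.erase r) (by simp) hh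
      (Function.update (fun _ => 0) r y)
    unfold lmarginal at h1 ⊢
    have h2 : ∀ z : (∀ _ : (Finset.univ.erase r : Finset (Fin n)), EuclideanSpace ℝ (Fin d)),
        Function.updateFinset (π := fun _ => EuclideanSpace ℝ (Fin d))
          (Function.update (fun _ => 0) r y) (Finset.univ.erase r) z r = y := by
      intro z
      simp [Function.updateFinset]
    simp only [h2]
    rw [lintegral_const_mul]
    · gcongr
    · exact hmeas.comp measurable_updateFinset
  refine (lintegral_mono hle).trans ?_
  rw [lintegral_mul_const _ hind, lintegral_indicator_one hΛ]

lemma mayerCoeff_bound {d : ℕ} (β B : ℝ) (hβ : 0 < β) (hB : 0 ≤ B)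
    (V : EuclideanSpace ℝ (Fin d) → ℝ) (hVmeas : Measurable V)
    (hVsymm : ∀ x, V (-x) = V x)
    (hstab : ∀ (n : ℕ), 2 ≤ n → ∀ x : Fin n → EuclideanSpace ℝ (Fin d),
      -(B * n) ≤ pairEnergy V x)
    (hC : Integrable (fun x : EuclideanSpace ℝ (Fin d) => 1 - Real.exp (-(β * |V x|))))
    (Λ : Set (EuclideanSpace ℝ (Fin d))) (hΛmeas : MeasurableSet Λ)
    (hΛbdd : Bornology.IsBounded Λ) (hΛpos : 0 < volume Λ) (n : ℕ) (hn : 2 ≤ n) :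
    |mayerCoeff β V Λ n| ≤
        Real.exp (β * B * n) * (n : ℝ) ^ (n - 2) *
          (∫ x : EuclideanSpace ℝ (Fin d), 1 - Real.exp (-(β * |V x|))) ^ (n - 1) /
            (n.factorial : ℝ) := by
  set F : EuclideanSpace ℝ (Fin d) → ℝ := fun x => 1 - Real.exp (-(β * |V x|)) with hF
  have hF0 : ∀ x, 0 ≤ F x := by
    intro x
    have : 0 ≤ β * |V x| := by positivity
    simp [hF, this]
  have hFm : Measurable F := by
    simp only [hF]
    fun_prop
  set C := ∫ x, F x with hCdef
  have hC0 : 0 ≤ C := integral_nonneg hF0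
  have hΛfin : volume Λ ≠ ⊤ := hΛbdd.measure_lt_top.ne
  have hΛr : 0 < (volume Λ).toReal := ENNReal.toReal_pos hΛpos.ne' hΛfin
  let r : Fin n := ⟨0, by omega⟩
  set PF := parentFns {r} (Finset.univ.erase r) with hPF
  have hlF : ∫⁻ y, ENNReal.ofReal (F y) = ENNReal.ofReal C :=
    (ofReal_integral_eq_lintegral_ofReal hC (Filter.Eventually.of_forall hF0)).symm
  have hmeasp : ∀ p : Fin n → Fin n, Measurable (fun x : Fin n → EuclideanSpace ℝ (Fin d) =>
      ∏ v ∈ Finset.univ.erase r, ENNReal.ofReal (F (x v - x (p v)))) := by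
    intro p
    refine Finset.measurable_prod _ fun u _ => (hFm.comp ?_).ennreal_ofReal
    exact (measurable_pi_apply u).sub (measurable_pi_apply (p u))
  have hint : ‖∫ x in Set.univ.pi (fun _ : Fin n => Λ), ursell β V x‖ₑ ≤
      ENNReal.ofReal (Real.exp (β * B * n) * (n ^ (n - 2) * ((volume Λ).toReal * C ^ (n - 1)))) := by
    calc _ ≤ ∫⁻ x in Set.univ.pi (fun _ : Fin n => Λ), ‖ursell β V x‖ₑ :=
          enorm_integral_le_lintegral_enorm _
      _ ≤ ∫⁻ x in Set.univ.pi (fun _ : Fin n => Λ), ENNReal.ofReal (Real.exp (β * B * n)) *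
          ∑ p ∈ PF, ∏ v ∈ Finset.univ.erase r, ENNReal.ofReal (F (x v - x (p v))) := by
          apply lintegral_mono
          intro x
          simp only
          rw [Real.enorm_eq_ofReal_abs]
          refine (ENNReal.ofReal_le_ofReal (abs_ursell_le hβ hB hVsymm hstab x r)).trans ?_
          rw [ENNReal.ofReal_mul (Real.exp_pos _).le, ENNReal.ofReal_sum_of_nonneg]
          · gcongr with p hp
            rw [ENNReal.ofReal_prod_of_nonneg]
            exact fun v _ => hF0 _
          · exact fun p _ => Finset.prod_nonneg fun v _ => hF0 _
      _ = ENNReal.ofReal (Real.exp (β * B * n)) * ∑ p ∈ PF,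
          ∫⁻ x in Set.univ.pi (fun _ : Fin n => Λ),
            ∏ v ∈ Finset.univ.erase r, ENNReal.ofReal (F (x v - x (p v))) := by
          rw [lintegral_const_mul _ (Finset.measurable_sum _ fun p _ => hmeasp p),
            lintegral_finsetSum _ fun p _ => hmeasp p]
      _ ≤ ENNReal.ofReal (Real.exp (β * B * n)) * ∑ p ∈ PF,
          (volume Λ * (ENNReal.ofReal C) ^ (n - 1)) := by
          gcongr with p hp
          rw [← hlF]
          exact lintegral_tree (f := fun y => ENNReal.ofReal (F y)) hFm.ennreal_ofReal r p hp Λ hΛmeas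
      _ ≤ ENNReal.ofReal (Real.exp (β * B * n)) *
          (((n ^ (n - 2) : ℕ) : ENNReal) * (volume Λ * (ENNReal.ofReal C) ^ (n - 1))) := by
          rw [Finset.sum_const, nsmul_eq_mul]
          gcongr
          exact card_parentFns_root hn r
      _ = _ := by
          rw [ENNReal.ofReal_mul (Real.exp_pos _).le, ENNReal.ofReal_mul (by positivity),
            ENNReal.ofReal_mul (by positivity), ENNReal.ofReal_toReal hΛfin,
            ENNReal.ofReal_pow hC0]
          congr 2
          rw [← Nat.cast_pow, ENNReal.ofReal_natCast]
  rw [Real.enorm_eq_ofReal_abs, ENNReal.ofReal_le_ofReal_iff (by positivity)] at hint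
  unfold mayerCoeff
  rw [if_neg (by omega), abs_mul, abs_of_nonneg (by positivity)]
  calc _ ≤ ((n.factorial : ℝ) * (volume Λ).toReal)⁻¹ *
      (Real.exp (β * B * n) * (n ^ (n - 2) * ((volume Λ).toReal * C ^ (n - 1)))) := by gcongr
    _ = _ := by
      have : (n.factorial : ℝ) ≠ 0 := by positivity
      field_simp

/-- Improved (Procacci–Yuhjtman) bound: for a stable and tempered pair potential,
`|C_n(β,Λ)| ≤ e^{βBn} n^{n-2} C̃(β)^{n-1}/n!` with `C̃(β) = ∫ (1 - e^{-β|V(x)|}) dx`,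
and hence the Mayer series converges absolutely (uniformly in `Λ`) for
`|λ| < 1/(e^{βB+1} C̃(β))`. -/
theorem statement15 {d : ℕ} (β B : ℝ) (hβ : 0 < β) (hB : 0 ≤ B)
    (V : EuclideanSpace ℝ (Fin d) → ℝ) (hVmeas : Measurable V)
    (hVsymm : ∀ x, V (-x) = V x)
    (hstab : ∀ (n : ℕ), 2 ≤ n → ∀ x : Fin n → EuclideanSpace ℝ (Fin d),
      -(B * n) ≤ pairEnergy V x)
    (hC : Integrable (fun x : EuclideanSpace ℝ (Fin d) => 1 - Real.exp (-(β * |V x|))))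
    (Λ : Set (EuclideanSpace ℝ (Fin d))) (hΛmeas : MeasurableSet Λ)
    (hΛbdd : Bornology.IsBounded Λ) (hΛpos : 0 < volume Λ) :
    (∀ n : ℕ, 2 ≤ n →
      |mayerCoeff β V Λ n| ≤
        Real.exp (β * B * n) * (n : ℝ) ^ (n - 2) *
          (∫ x : EuclideanSpace ℝ (Fin d), 1 - Real.exp (-(β * |V x|))) ^ (n - 1) /
            (n.factorial : ℝ)) ∧
    ∀ lam : ℂ,
      ‖lam‖ < 1 / (Real.exp (β * B + 1) *
          ∫ x : EuclideanSpace ℝ (Fin d), 1 - Real.exp (-(β * |V x|))) →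
        Summable (fun n : ℕ => |mayerCoeff β V Λ (n + 1)| * ‖lam‖ ^ (n + 1)) := by
  have hbound := mayerCoeff_bound β B hβ hB V hVmeas hVsymm hstab hC Λ hΛmeas hΛbdd hΛpos
  refine ⟨hbound, ?_⟩
  intro lam hlam
  set C := ∫ x : EuclideanSpace ℝ (Fin d), 1 - Real.exp (-(β * |V x|)) with hCdef
  have hC0 : 0 ≤ C := integral_nonneg fun x => by
    have : 0 ≤ β * |V x| := by positivity
    simp [this]
  have hCpos : 0 < C := by
    rcases hC0.eq_or_lt with h | h
    · rw [← h] at hlam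
      simp only [mul_zero, div_zero] at hlam
      exact absurd (norm_nonneg lam) (not_le.2 hlam)
    · exact h
  set q := Real.exp (β * B + 1) * C * ‖lam‖ with hq
  have hq0 : 0 ≤ q := by positivity
  have hq1 : q < 1 := by
    rw [lt_div_iff₀ (by positivity)] at hlam
    rw [hq]; linarith
  rw [← summable_nat_add_iff 1]
  refine Summable.of_nonneg_of_le (fun n => by positivity) (fun n => ?_)
    ((summable_geometric_of_lt_one hq0 hq1).mul_left (q ^ 2 / C))
  have hb := hbound (n + 2) (by omega)
  have e1 : n + 2 - 2 = n := by omega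
  have e2 : n + 2 - 1 = n + 1 := by omega
  rw [e1, e2] at hb
  have hexp : ((n + 2 : ℕ) : ℝ) ^ n / ((n + 2).factorial : ℝ) ≤ Real.exp (n + 2 : ℕ) := by
    refine le_trans ?_ (Real.pow_div_factorial_le_exp ((n + 2 : ℕ) : ℝ) (by positivity) (n + 2))
    gcongr
    · push_cast; linarith
    · omega
  calc |mayerCoeff β V Λ (n + 1 + 1)| * ‖lam‖ ^ (n + 1 + 1)
      ≤ (Real.exp (β * B * (n + 2 : ℕ)) * ((n + 2 : ℕ) : ℝ) ^ n * C ^ (n + 1) /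
        ((n + 2).factorial : ℝ)) * ‖lam‖ ^ (n + 2) := by gcongr
    _ = Real.exp (β * B * (n + 2 : ℕ)) * (((n + 2 : ℕ) : ℝ) ^ n / ((n + 2).factorial : ℝ)) *
        C ^ (n + 1) * ‖lam‖ ^ (n + 2) := by ring
    _ ≤ Real.exp (β * B * (n + 2 : ℕ)) * Real.exp (n + 2 : ℕ) *
        C ^ (n + 1) * ‖lam‖ ^ (n + 2) := by gcongr
    _ = q ^ 2 / C * q ^ n := by
      have h3 : Real.exp (β * B * (n + 2 : ℕ)) * Real.exp (n + 2 : ℕ) =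
          Real.exp (β * B + 1) ^ (n + 2) := by
        rw [← Real.exp_add, ← Real.exp_nat_mul]
        congr 1
        ring
      rw [h3, hq]
      field_simp
      ring

end
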